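/- arXiv:1208.3177 — 3 statements merged into one kernel-verified Lean document; each statement's English description precedes it below -/
import Mathlib

section
/- If α is an automorphism of a finite group G with gcd(|α|, |G|) = 1, then [G,α] = [[G,α],α]. In particular, if [[G,α],α] = 1 then α is the identity. -/
/-- If a power of prime exponent `p` of the automorphism `β` fixes the `β`-invariant coset `gH`
pointwise and `p` does not divide `|H|`, then `β` fixes a point of `gH`. -/
theorem MulAut.exists_fixed_mem_coset_of_prime {G : Type*} [Group G] [Finite G] (β : MulAut G)
    {p : ℕ} (hp : p.Prime) {H : Subgroup G} (hpH : p.Coprime (Nat.card H)) {g : G}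
    (hβ : ∀ h ∈ H, g⁻¹ * β (g * h) ∈ H) (hfix : ∀ h ∈ H, (β ^ p) (g * h) = g * h) :
    ∃ h ∈ H, β (g * h) = g * h := by
  classical
  have : Fact p.Prime := ⟨hp⟩
  have : Fintype H := Fintype.ofFinite H
  let f : Function.End H := fun h => ⟨g⁻¹ * β (g * h), hβ h h.2⟩
  have hf_pow (k : ℕ) (h : H) : (((f ^ k : Function.End H) h : H) : G)
      = g⁻¹ * (β ^ k) (g * h) := by
    induction k with
    | zero => simp [Function.End.one_def]
    | succ k ih =>
      have hcomp : (f ^ (k + 1) : Function.End H) h = f ((f ^ k : Function.End H) h) := by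
        rw [pow_succ']; rfl
      rw [hcomp]
      change g⁻¹ * β (g * _) = _
      rw [ih, pow_succ', MulAut.mul_apply, mul_inv_cancel_left]
  have hf : f ^ p ^ 1 = 1 := by
    funext h
    apply Subtype.ext
    rw [pow_one, hf_pow, hfix h h.2, inv_mul_cancel_left]
    rfl
  have hcard := Equiv.Perm.card_fixedPoints_modEq hf
  have hne : Nonempty (Function.fixedPoints f) := by
    by_contra hempty
    rw [not_nonempty_iff] at hempty
    rw [Fintype.card_eq_zero (α := Function.fixedPoints f), Nat.modEq_zero_iff_dvd,
      ← Nat.card_eq_fintype_card] at hcard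
    exact (Nat.Prime.coprime_iff_not_dvd hp).1 hpH hcard
  obtain ⟨h, hh⟩ := hne
  exact ⟨h, h.2, inv_mul_eq_iff_eq_mul.1 (congrArg Subtype.val hh)⟩

/-- If `α ^ n` fixes the `α`-invariant coset `gH` pointwise, `H` is `α`-invariant and `n` is coprime
to `|H|`, then `α` fixes a point of `gH`. -/
theorem MulAut.exists_fixed_mem_coset_of_coprime {G : Type*} [Group G] [Finite G] (α : MulAut G)
    {n : ℕ} {H : Subgroup G} (hn : n.Coprime (Nat.card H)) {g : G} (hH : ∀ h ∈ H, α h ∈ H)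
    (hg : g⁻¹ * α g ∈ H) (hfix : ∀ h ∈ H, (α ^ n) (g * h) = g * h) :
    ∃ h ∈ H, α (g * h) = g * h := by
  induction n using induction_on_primes generalizing H g with
  | zero =>
    rw [Nat.coprime_zero_left, Subgroup.card_eq_one] at hn
    subst hn
    exact ⟨1, one_mem _, by
      simpa using (inv_mul_eq_one.1 (Subgroup.mem_bot.1 hg)).symm⟩
  | one => exact ⟨1, one_mem _, by simpa using hfix 1 (one_mem _)⟩
  | prime_mul p a hp ih =>
    have hmem (k : ℕ) : ∀ h ∈ H, g⁻¹ * (α ^ k) (g * h) ∈ H := by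
      induction k with
      | zero => simp
      | succ k ihk =>
        intro h hh
        have := mul_mem hg (hH _ (ihk h hh))
        rwa [map_mul, map_inv, mul_assoc, mul_inv_cancel_left, ← MulAut.mul_apply, ← pow_succ']
          at this
    obtain ⟨h, hh, hfixed⟩ := (α ^ a).exists_fixed_mem_coset_of_prime hp
      (hn.coprime_dvd_left (dvd_mul_right p a)) (hmem a)
      (by simpa only [← pow_mul, mul_comm a p] using hfix)
    have hcomm (x : G) : (α ^ a) (α x) = α ((α ^ a) x) := by
      rw [← MulAut.mul_apply, ← MulAut.mul_apply, ← pow_succ, ← pow_succ']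
    let K : Subgroup G := H ⊓ (α ^ a).toMonoidHom.eqLocus (MonoidHom.id G)
    have hK {x : G} : x ∈ K ↔ x ∈ H ∧ (α ^ a) x = x := Iff.rfl
    obtain ⟨k, hk, hαk⟩ := ih (H := K) (g := g * h)
      ((hn.coprime_dvd_left (dvd_mul_left a p)).coprime_dvd_right
        (Subgroup.card_dvd_of_le inf_le_left))
      (fun x hx => hK.2 ⟨hH x (hK.1 hx).1, by rw [hcomm, (hK.1 hx).2]⟩)
      (hK.2 ⟨by
          have := mul_mem (inv_mem hh) (hmem 1 h hh)
          rwa [pow_one, ← mul_assoc, ← mul_inv_rev] at this,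
        by rw [map_mul, map_inv, hcomm, hfixed]⟩)
      (fun x hx => by rw [map_mul, hfixed, (hK.1 hx).2])
    exact ⟨h * k, mul_mem hh (hK.1 hk).1, by rwa [← mul_assoc]⟩

/-- If `α` is an automorphism of a finite group `G` with `gcd(|α|,|G|) = 1`, then
`[G,α] = [[G,α],α]`; in particular if `[[G,α],α] = 1` then `α = 1`. -/
theorem coprime_automorphism_commutator_stability (G : Type*) [Group G] [Finite G]
    (α : MulAut G) (hcop : Nat.Coprime (orderOf α) (Nat.card G)) :
    Subgroup.closure {z : G | ∃ g : G, z = g⁻¹ * α g} =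
        Subgroup.closure {z : G |
          ∃ h ∈ Subgroup.closure {w : G | ∃ g : G, w = g⁻¹ * α g}, z = h⁻¹ * α h} ∧
      (Subgroup.closure {z : G |
          ∃ h ∈ Subgroup.closure {w : G | ∃ g : G, w = g⁻¹ * α g}, z = h⁻¹ * α h} = ⊥ →
        α = 1) := by
  set N := Subgroup.closure {w : G | ∃ g : G, w = g⁻¹ * α g} with hN
  have hmem (g : G) : g⁻¹ * α g ∈ N := Subgroup.subset_closure ⟨g, rfl⟩
  have hinv : ∀ h ∈ N, α h ∈ N := fun h hh => by
    simpa using mul_mem hh (hmem h)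
  have hset : {z : G | ∃ g : G, z = g⁻¹ * α g} = {z : G | ∃ h ∈ N, z = h⁻¹ * α h} := by
    ext z
    refine ⟨?_, fun ⟨h, _, hz⟩ => ⟨h, hz⟩⟩
    rintro ⟨g, rfl⟩
    obtain ⟨n, hn, hfixed⟩ := α.exists_fixed_mem_coset_of_coprime
      (hcop.coprime_dvd_right N.card_subgroup_dvd_card) hinv (hmem g)
      (fun h _ => by rw [pow_orderOf_eq_one, MulAut.one_apply])
    refine ⟨n⁻¹, inv_mem hn, ?_⟩
    rw [map_mul, ← eq_mul_inv_iff_mul_eq] at hfixed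
    rw [hfixed, map_inv]
    group
  have heq : N = Subgroup.closure {z : G | ∃ h ∈ N, z = h⁻¹ * α h} := by
    rw [← hset]
  refine ⟨heq, fun hbot => ?_⟩
  rw [← heq] at hbot
  ext g
  have hg := hmem g
  rw [hbot, Subgroup.mem_bot, inv_mul_eq_one] at hg
  exact hg.symm
end

section
/- Let G be a finite group and k a positive integer. Then γ_k*(G) = 1 if and only if G is nilpotent (for k ≥ 2), where γ_k*(G) is the subgroup generated by all γ_k*-commutators. -/
/-- The set of `γ_k*`-commutators of a group: every element is a
`γ_1*`-commutator, and for `k ≥ 2` an element is a `γ_k*`-commutator if it is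
`[a,b]` where `a` is a power of a `γ_{k-1}*`-commutator, `b` is any element,
and `a, b` have coprime orders. (`gammaStar 0` is a dummy value.) -/
def gammaStar (G : Type*) [Group G] : ℕ → Set G
  | 0 => Set.univ
  | 1 => Set.univ
  | k + 2 => {x : G | ∃ a b : G,
      (∃ c ∈ gammaStar G (k + 1), ∃ n : ℕ, a = c ^ n) ∧
      Nat.Coprime (orderOf a) (orderOf b) ∧
      x = a⁻¹ * b⁻¹ * a * b}

open Subgroup in
/-- In a nilpotent group, elements of coprime orders commute. -/
theorem Group.IsNilpotent.commute_of_coprime_orderOf {G : Type*} [Group G] [Group.IsNilpotent G]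
    {a b : G} (h : (orderOf a).Coprime (orderOf b)) : Commute a b := by
  revert a b
  refine Group.nilpotent_center_quotient_ind
    (P := fun G _ _ ↦ ∀ {a b : G}, (orderOf a).Coprime (orderOf b) → Commute a b) G ?_ ?_
  · intro G _ _ a b _
    exact Subsingleton.elim _ _
  · intro G _ _ ih a b h
    have hq := ih (a := (a : G ⧸ center G)) (b := (b : G ⧸ center G))
      ((h.coprime_dvd_left (orderOf_map_dvd (QuotientGroup.mk' (center G)) a)).coprime_dvd_right
        (orderOf_map_dvd (QuotientGroup.mk' (center G)) b))
    obtain ⟨z, hz, hab⟩ : ∃ z ∈ center G, a * b = b * a * z := by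
      refine ⟨(b * a)⁻¹ * (a * b), ?_, by group⟩
      rw [← QuotientGroup.eq]
      exact hq.eq.symm
    have hzc (g : G) : Commute g z := mem_center_iff.mp hz g
    have h1 : z ^ orderOf a = 1 := by
      have hc : b⁻¹ * a * b = a * z := by
        rw [mul_assoc, hab]; group
      have := congrArg (· ^ orderOf a) hc
      simpa [(hzc a).mul_pow, pow_orderOf_eq_one, conj_pow (a := b⁻¹)] using this.symm.trans
        (by simpa [pow_orderOf_eq_one] using conj_pow (i := orderOf a) (a := b⁻¹) (b := a))
    have h2 : z ^ orderOf b = 1 := by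
      have hc : a * b * a⁻¹ = b * z := by
        rw [hab, mul_assoc, mul_assoc, ← (hzc a⁻¹).eq]; group
      have := congrArg (· ^ orderOf b) hc
      simpa [(hzc b).mul_pow, pow_orderOf_eq_one, conj_pow] using this.symm
    have hz1 : z = 1 := orderOf_eq_one_iff.mp
      (Nat.eq_one_of_dvd_coprimes h (orderOf_dvd_of_pow_eq_one h1) (orderOf_dvd_of_pow_eq_one h2))
    rw [hz1, mul_one] at hab
    exact hab

theorem gammaStar_subset_one_of_isNilpotent (G : Type*) [Group G] [Group.IsNilpotent G]
    {k : ℕ} (hk : 2 ≤ k) : gammaStar G k ⊆ {1} := by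
  obtain ⟨k, rfl⟩ := Nat.exists_eq_add_of_le' hk
  rintro _ ⟨a, b, -, hab, rfl⟩
  have := (Group.IsNilpotent.commute_of_coprime_orderOf hab).eq
  rw [Set.mem_singleton_iff, mul_assoc, this]
  group

/-- Injective homomorphisms map `γ_k*`-commutators to `γ_k*`-commutators. -/
theorem map_mem_gammaStar {G H : Type*} [Group G] [Group H] {f : H →* G}
    (hf : Function.Injective f) :
    ∀ {k : ℕ} {x : H}, x ∈ gammaStar H k → f x ∈ gammaStar G k
  | 0, _, _ => trivial
  | 1, _, _ => trivial
  | k + 2, _, ⟨_, b, ⟨c, hc, n, rfl⟩, hab, rfl⟩ =>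
    ⟨f (c ^ n), f b, ⟨f c, map_mem_gammaStar hf hc, n, map_pow f c n⟩, by
      rwa [orderOf_injective f hf, orderOf_injective f hf], by simp⟩

/-- A power of `a` with the same image as `a` has only the prime divisors of the order of
the image. -/
theorem exists_pow_map_eq_and_coprime {G H : Type*} [Group G] [Finite G] [Group H] (f : G →* H)
    (a : G) : ∃ i : ℕ, f (a ^ i) = f a ∧
      ∀ p : ℕ, p.Prime → p ∣ orderOf (a ^ i) → p ∣ orderOf (f a) := by
  induction hn : orderOf a using Nat.strong_induction_on generalizing a with
  | _ n ih =>
    by_cases h : ∀ p : ℕ, p.Prime → p ∣ orderOf a → p ∣ orderOf (f a)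
    · exact ⟨1, by simpa using h⟩
    push Not at h
    obtain ⟨p, hp, hpa, hpf⟩ := h
    obtain ⟨t, ht⟩ := exists_pow_eq_self_of_coprime (hp.coprime_iff_not_dvd.mpr hpf)
    have hlt : orderOf ((a ^ p) ^ t) < n := by
      refine (Nat.le_of_dvd (orderOf_pos _) (orderOf_pow_dvd t)).trans_lt ?_
      rw [orderOf_pow_of_dvd hp.ne_zero hpa, ← hn]
      exact Nat.div_lt_self (orderOf_pos a) hp.one_lt
    obtain ⟨i, hi, hi'⟩ := ih _ hlt _ rfl
    have ht' : f ((a ^ p) ^ t) = f a := by rw [map_pow, map_pow, ht]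
    rw [ht', ← pow_mul, ← pow_mul] at hi hi'
    exact ⟨p * (t * i), hi, hi'⟩

/-- Along a surjective homomorphism of a finite group, `γ_k*`-commutators lift to
`γ_k*`-commutators. -/
theorem exists_mem_gammaStar_map_eq {G H : Type*} [Group G] [Finite G] [Group H] {f : G →* H}
    (hf : Function.Surjective f) :
    ∀ {k : ℕ} {y : H}, y ∈ gammaStar H k → ∃ x ∈ gammaStar G k, f x = y
  | 0, y, _ => (hf y).imp fun _ h ↦ ⟨trivial, h⟩
  | 1, y, _ => (hf y).imp fun _ h ↦ ⟨trivial, h⟩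
  | k + 2, _, ⟨_, b, ⟨c, hc, n, rfl⟩, hab, rfl⟩ => by
    obtain ⟨c, hc', rfl⟩ := exists_mem_gammaStar_map_eq hf hc
    obtain ⟨b, rfl⟩ := hf b
    rw [← map_pow] at hab ⊢
    obtain ⟨i, hi, hi'⟩ := exists_pow_map_eq_and_coprime f (c ^ n)
    obtain ⟨j, hj, hj'⟩ := exists_pow_map_eq_and_coprime f b
    refine ⟨_, ⟨(c ^ n) ^ i, b ^ j, ⟨c, hc', n * i, (pow_mul c n i).symm⟩, ?_, rfl⟩, ?_⟩
    · refine Nat.Coprime.symm (Nat.coprime_of_dvd fun p hp h1 h2 ↦ ?_)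
      exact hp.one_lt.ne' (Nat.eq_one_of_dvd_coprimes hab (hi' p hp h2) (hj' p hp h1))
    · simp only [map_mul, map_inv, hi, hj]

/-- If `[[x, b], b] = 1` and `[x, b]`, `b` have coprime orders, then `[x, b] = 1`. -/
theorem commutator_eq_one_of_commute_of_coprime {G : Type*} [Group G] {x b : G}
    (hc : Commute (x⁻¹ * b⁻¹ * x * b) b)
    (hco : (orderOf (x⁻¹ * b⁻¹ * x * b)).Coprime (orderOf b)) :
    x⁻¹ * b⁻¹ * x * b = 1 := by
  set y := x⁻¹ * b⁻¹ * x * b with hy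
  have h1 : x⁻¹ * b * x = b * y⁻¹ := by
    rw [hy]; group
  have h2 : y ^ orderOf b = 1 := by
    have h3 : (x⁻¹ * b * x) ^ orderOf b = 1 := by
      simpa [pow_orderOf_eq_one] using conj_pow (i := orderOf b) (a := x⁻¹) (b := b)
    rw [h1, hc.symm.inv_right.mul_pow, pow_orderOf_eq_one, one_mul, inv_pow, inv_eq_one] at h3
    exact h3
  exact orderOf_eq_one_iff.mp
    (Nat.eq_one_of_dvd_coprimes hco dvd_rfl (orderOf_dvd_of_pow_eq_one h2))

/-- If all `γ_k*`-commutators are trivial, then elements of order prime to `p` centralize normal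
`p`-subgroups. -/
theorem commute_of_gammaStar_subset_one {G : Type*} [Group G] {k : ℕ} (hk : 2 ≤ k)
    (h : gammaStar G k ⊆ {1}) {p : ℕ} {P : Subgroup G} [P.Normal] (hP : IsPGroup p P)
    {x b : G} (hx : x ∈ P) (hb : p.Coprime (orderOf b)) : Commute x b := by
  let e : ℕ → G := fun n ↦ (fun y ↦ y⁻¹ * b⁻¹ * y * b)^[n] x
  have he (n : ℕ) : e (n + 1) = (e n)⁻¹ * b⁻¹ * e n * b := Function.iterate_succ_apply' _ _ _
  have heP (n : ℕ) : e n ∈ P := by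
    induction n with
    | zero => exact hx
    | succ n ih =>
      rw [he, mul_assoc, mul_assoc, ← mul_assoc b⁻¹]
      refine P.mul_mem (P.inv_mem ih) ?_
      simpa using ‹P.Normal›.conj_mem _ ih b⁻¹
  have hco (n : ℕ) : (orderOf (e n)).Coprime (orderOf b) := by
    simpa using hP.orderOf_coprime hb ⟨e n, heP n⟩
  have hmem (n : ℕ) : e n ∈ gammaStar G (n + 1) := by
    induction n with
    | zero => trivial
    | succ n ih => exact ⟨e n, b, ⟨e n, ih, 1, (pow_one _).symm⟩, hco n, he n⟩
  have hdesc (n : ℕ) (hn : e (n + 1) = 1) : e 1 = 1 := by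
    induction n with
    | zero => exact hn
    | succ n ih =>
      refine ih ?_
      rw [he] at hn ⊢
      refine commutator_eq_one_of_commute_of_coprime ?_ ?_
      · rw [← he]
        have := congrArg (b * e (n + 1) * ·) hn
        simpa [commute_iff_eq, mul_assoc] using this
      · rw [← he]; exact hco _
  have h1 : x⁻¹ * b⁻¹ * x * b = 1 := by
    rw [← hdesc (k - 2) (h (by convert hmem (k - 2 + 1) using 1; congr 1; omega))]
    rfl
  have := congrArg (b * x * ·) h1
  simpa [commute_iff_eq, mul_assoc] using this

namespace Subgroup

/-- If the proper subgroups of a finite simple group are nilpotent, then distinct maximal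
subgroups intersect trivially. -/
theorem inf_eq_bot_of_isCoatom {G : Type*} [Group G] [Finite G]
    (hnil : ∀ H : Subgroup G, H ≠ ⊤ → Group.IsNilpotent H)
    (hs : ∀ N : Subgroup G, N.Normal → N = ⊥ ∨ N = ⊤)
    {M₁ M₂ : Subgroup G} (h₁ : IsCoatom M₁) (h₂ : IsCoatom M₂) (hne : M₁ ≠ M₂) :
    M₁ ⊓ M₂ = ⊥ := by
  obtain ⟨n, hn⟩ : ∃ n, Nat.card G - Nat.card (M₁ ⊓ M₂ : Subgroup G) = n := ⟨_, rfl⟩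
  induction n using Nat.strong_induction_on generalizing M₁ M₂ with
  | _ n ih =>
    by_contra hD
    set D := M₁ ⊓ M₂
    have hDtop : D ≠ ⊤ := fun h ↦ h₁.1 (top_le_iff.mp (h ▸ inf_le_left))
    have hN : normalizer (D : Set G) ≠ ⊤ := fun h ↦
      (hs D (normalizer_eq_top_iff.mp h)).elim hD hDtop
    obtain ⟨M, hM, hNM⟩ := (eq_top_or_exists_le_coatom _).resolve_left hN
    have key {K : Subgroup G} (hK : IsCoatom K) (hDK : D < K) : M = K := by
      by_contra hMK
      have := hnil K hK.1
      have hlt : D.subgroupOf K < ⊤ := by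
        rw [lt_top_iff_ne_top, Ne, subgroupOf_eq_top]
        exact not_le_of_gt hDK
      have hlt' := Group.normalizerCondition_of_isNilpotent _ hlt
      rw [← subgroupOf_normalizer_eq hDK.le] at hlt'
      have hlt2 : D < M ⊓ K := by
        refine lt_of_le_of_ne (le_inf (le_normalizer.trans hNM) hDK.le) fun heq ↦ ?_
        refine not_le_of_gt hlt' fun x hx ↦ ?_
        rw [mem_subgroupOf] at hx ⊢
        rw [heq]
        exact ⟨hNM hx, x.2⟩
      have hcard : Nat.card D < Nat.card (M ⊓ K : Subgroup G) :=
        Set.Finite.card_lt_card (Set.toFinite _) hlt2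
      have := card_le_card_group D
      have := card_le_card_group (M ⊓ K)
      exact (bot_le.trans_lt hlt2).ne' (ih _ (by omega) hM hK hMK rfl)
    have hlt₁ : D < M₁ := lt_of_le_of_ne inf_le_left fun h ↦ hne
      ((h₁.le_iff.mp (inf_eq_left.mp h)).resolve_left h₂.1).symm
    have hlt₂ : D < M₂ := lt_of_le_of_ne inf_le_right fun h ↦ hne
      ((h₂.le_iff.mp (inf_eq_right.mp h)).resolve_left h₁.1)
    exact hne ((key h₁ hlt₁).symm.trans (key h₂ hlt₂))

/-- The number of nontrivial elements in the conjugates of a subgroup `M` that intersects its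
conjugates by elements outside `M` trivially. -/
theorem ncard_conjugates_add_index {G : Type*} [Group G] [Finite G] (M : Subgroup G)
    (hM : ∀ m ∈ M, m ≠ 1 → ∀ g, g * m * g⁻¹ ∈ M → g ∈ M) :
    {x : G | x ≠ 1 ∧ ∃ g, g * x * g⁻¹ ∈ M}.ncard + M.index = Nat.card G := by
  let f : (G ⧸ M) × {m : M // m ≠ 1} → G := fun q ↦ q.1.out * q.2.1 * q.1.out⁻¹
  have hf : Function.Injective f := by
    rintro ⟨q, m, hm⟩ ⟨r, n, hn⟩ h
    have h' : q.out * m * q.out⁻¹ = r.out * n * r.out⁻¹ := h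
    have hmem : r.out⁻¹ * q.out ∈ M := by
      refine hM m m.2 (by simpa using hm) _ ?_
      have : r.out⁻¹ * q.out * m * (r.out⁻¹ * q.out)⁻¹ = n := by
        rw [mul_inv_rev, inv_inv, mul_assoc, mul_assoc, ← mul_assoc (m : G), ← mul_assoc q.out,
          ← mul_assoc q.out, h']
        group
      rw [this]
      exact n.2
    have hqr : q = r := by
      rw [← QuotientGroup.eq, QuotientGroup.out_eq', QuotientGroup.out_eq'] at hmem
      exact hmem.symm
    subst hqr
    simpa using h'
  have hrange : Set.range f = {x : G | x ≠ 1 ∧ ∃ g, g * x * g⁻¹ ∈ M} := by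
    ext x
    constructor
    · rintro ⟨⟨q, m, hm⟩, rfl⟩
      refine ⟨by simpa [f] using hm, q.out⁻¹, ?_⟩
      simp [f, mul_assoc]
    · rintro ⟨hx, g, hg⟩
      obtain ⟨h, hh⟩ := QuotientGroup.mk_out_eq_mul M g⁻¹
      refine ⟨⟨(g⁻¹ : G), ⟨h⁻¹ * ⟨_, hg⟩ * h, ?_⟩⟩, ?_⟩
      · intro h1
        apply hx
        have h2 := congrArg Subtype.val (conj_eq_one_iff (a := h⁻¹) |>.mp (by simpa using h1))
        exact conj_eq_one_iff.mp h2
      · simp only [f, hh]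
        simp [mul_assoc]
  have hcard : Nat.card {m : M // m ≠ 1} + 1 = Nat.card M := by
    have := Set.ncard_add_ncard_compl ({1} : Set M)
    rw [Set.ncard_singleton] at this
    rw [← this, add_comm]
    rfl
  rw [← hrange, ← Nat.card_coe_set_eq, Nat.card_range_of_injective hf, Nat.card_prod,
    ← M.index_mul_card, ← hcard, index, mul_add, mul_one]

end Subgroup

open Subgroup in
/-- A finite non-nilpotent group whose proper subgroups are nilpotent is not simple. -/
theorem exists_normal_of_forall_isNilpotent {G : Type*} [Group G] [Finite G]
    (hnil : ∀ H : Subgroup G, H ≠ ⊤ → Group.IsNilpotent H) (hG : ¬ Group.IsNilpotent G) :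
    ∃ N : Subgroup G, N.Normal ∧ N ≠ ⊥ ∧ N ≠ ⊤ := by
  by_contra! hs'
  have hs (N : Subgroup G) (hN : N.Normal) : N = ⊥ ∨ N = ⊤ := or_iff_not_imp_left.mpr (hs' N hN)
  have hti {M : Subgroup G} (hM : IsCoatom M) (hMn : ¬ M.Normal) :
      ∀ m ∈ M, m ≠ 1 → ∀ g, g * m * g⁻¹ ∈ M → g ∈ M := by
    intro m hm hm1 g hg
    have hN : normalizer (M : Set G) = M :=
      (hM.le_iff.mp le_normalizer).resolve_left fun h ↦ hMn (normalizer_eq_top_iff.mp h)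
    have hC : IsCoatom (M.comap (MulAut.conj g : G →* G)) := (isCoatom_comap _).mpr hM
    have heq : M = M.comap (MulAut.conj g : G →* G) := by
      by_contra hne
      have hmem : m ∈ M ⊓ M.comap (MulAut.conj g : G →* G) := ⟨hm, hg⟩
      rw [inf_eq_bot_of_isCoatom hnil hs hM hC hne] at hmem
      exact hm1 hmem
    rw [← hN, mem_normalizer_iff]
    exact fun n ↦ SetLike.ext_iff.mp heq n
  have hindex {M : Subgroup G} (hM : IsCoatom M) (hMn : ¬ M.Normal) :
      2 ≤ M.index ∧ 2 * M.index ≤ Nat.card G := by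
    have h1 : M.index ≠ 1 := fun h ↦ hM.1 (index_eq_one.mp h)
    have h2 : M.index ≠ 0 := M.index_ne_zero_of_finite
    have h3 : 1 < Nat.card M := one_lt_card_iff_ne_bot M |>.mpr fun h ↦ hMn (h ▸ inferInstance)
    refine ⟨by omega, ?_⟩
    rw [← M.index_mul_card, mul_comm]
    exact Nat.mul_le_mul_left _ h3
  obtain ⟨M₁, hM₁, hn₁⟩ : ∃ M : Subgroup G, IsCoatom M ∧ ¬ M.Normal := by
    by_contra! h
    exact hG ((Group.isNilpotent_of_finite_tfae.out 0 2 rfl rfl).mpr h)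
  let U := fun M : Subgroup G ↦ {x : G | x ≠ 1 ∧ ∃ g, g * x * g⁻¹ ∈ M}
  have hU₁ : (U M₁).ncard + M₁.index = _ := ncard_conjugates_add_index M₁ (hti hM₁ hn₁)
  have hi₁ := hindex hM₁ hn₁
  have hone : ({1} : Set G)ᶜ.ncard + 1 = Nat.card G := by
    rw [← Set.ncard_add_ncard_compl ({1} : Set G), Set.ncard_singleton, add_comm]
  obtain ⟨x, hx1, hxU⟩ : ∃ x ∈ ({1} : Set G)ᶜ, x ∉ U M₁ :=
    Set.exists_mem_notMem_of_ncard_lt_ncard (by omega)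
  have hx : zpowers x ≠ ⊤ := by
    intro h
    have : IsCyclic G := ⟨x, fun y ↦ (h ▸ mem_top y : y ∈ zpowers x)⟩
    exact hG (@CommGroup.isNilpotent G IsCyclic.commGroup)
  obtain ⟨M₂, hM₂, hxM⟩ := (eq_top_or_exists_le_coatom _).resolve_left hx
  have hxM₂ : x ∈ M₂ := hxM (mem_zpowers x)
  have hn₂ : ¬ M₂.Normal := fun h ↦ (hs M₂ h).elim (fun h ↦ hx1 (by simpa [h] using hxM₂)) hM₂.1
  have hU₂ : (U M₂).ncard + M₂.index = _ := ncard_conjugates_add_index M₂ (hti hM₂ hn₂)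
  have hi₂ := hindex hM₂ hn₂
  have hdisj : Disjoint (U M₁) (U M₂) := by
    refine Set.disjoint_left.mpr ?_
    rintro y ⟨hy, g, hg⟩ ⟨-, h, hh⟩
    have hC₁ : IsCoatom (M₁.comap (MulAut.conj g : G →* G)) := (isCoatom_comap _).mpr hM₁
    have hC₂ : IsCoatom (M₂.comap (MulAut.conj h : G →* G)) := (isCoatom_comap _).mpr hM₂
    have heq : M₁.comap (MulAut.conj g : G →* G) = M₂.comap (MulAut.conj h : G →* G) := by
      by_contra hne
      have hmem : y ∈ M₁.comap (MulAut.conj g : G →* G) ⊓ M₂.comap (MulAut.conj h : G →* G) :=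
        ⟨hg, hh⟩
      rw [inf_eq_bot_of_isCoatom hnil hs hC₁ hC₂ hne] at hmem
      exact hy hmem
    refine hxU ⟨hx1, g * h⁻¹, ?_⟩
    have hmem : h⁻¹ * x * h ∈ M₂.comap (MulAut.conj h : G →* G) := by
      simpa [mul_assoc] using hxM₂
    rw [← heq] at hmem
    simpa [mul_assoc] using hmem
  have hle : (U M₁ ∪ U M₂).ncard ≤ ({1} : Set G)ᶜ.ncard :=
    Set.ncard_le_ncard (Set.union_subset (fun y hy ↦ hy.1) fun y hy ↦ hy.1)
  rw [Set.ncard_union_eq hdisj] at hle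
  omega

open Subgroup in
/-- Sylow subgroups of a nilpotent normal subgroup are normal in the whole group. -/
theorem Sylow.normal_of_le_of_isNilpotent {G : Type*} [Group G] [Finite G] {p : ℕ}
    [Fact p.Prime] (P : Sylow p G) {N : Subgroup G} [N.Normal] [Group.IsNilpotent N]
    (h : (P : Subgroup G) ≤ N) : (P : Subgroup G).Normal := by
  have : ((P.subtype h : Sylow p N) : Subgroup N).Characteristic :=
    Sylow.characteristic_of_normal _ inferInstance
  have := ConjAct.normal_of_characteristic_of_normal (H := N) (K := (P.subtype h : Subgroup N))
  rwa [P.coe_subtype, subgroupOf_map_subtype, inf_eq_left.mpr h] at this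

open Subgroup in
/-- A nontrivial nilpotent normal subgroup contains a nontrivial normal `p`-subgroup. -/
theorem exists_normal_isPGroup_of_isNilpotent {G : Type*} [Group G] [Finite G] {N : Subgroup G}
    [N.Normal] [Group.IsNilpotent N] (hN : N ≠ ⊥) :
    ∃ p : ℕ, p.Prime ∧ ∃ P : Subgroup G, P.Normal ∧ IsPGroup p P ∧ P ≠ ⊥ := by
  obtain ⟨p, hp, hpN⟩ := Nat.exists_prime_and_dvd ((one_lt_card_iff_ne_bot N).mpr hN).ne'
  have : Fact p.Prime := ⟨hp⟩
  obtain ⟨P⟩ : Nonempty (Sylow p N) := inferInstance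
  have : (P : Subgroup N).Characteristic := Sylow.characteristic_of_normal _ inferInstance
  refine ⟨p, hp, (P : Subgroup N).map N.subtype, inferInstance, P.2.map _, fun h ↦ ?_⟩
  exact P.ne_bot_of_dvd_card hpN ((map_eq_bot_iff_of_injective _ N.subtype_injective).mp h)

open Subgroup in
/-- A finite group is nilpotent if it has a normal `p`-subgroup with nilpotent centralizer, and
elements of order prime to a prime `q` centralize the normal `q`-subgroups. -/
theorem isNilpotent_of_isNilpotent_centralizer {G : Type*} [Group G] [Finite G]
    (hcomm : ∀ (q : ℕ) (Q : Subgroup G), Q.Normal → IsPGroup q Q → ∀ x ∈ Q, ∀ b : G,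
      q.Coprime (orderOf b) → Commute x b)
    {p : ℕ} (hp : p.Prime) {P : Subgroup G} [P.Normal] (hP : IsPGroup p P)
    (hC : Group.IsNilpotent (centralizer (P : Set G))) : Group.IsNilpotent G := by
  have hcop {q r : ℕ} (hq : q.Prime) (hr : r.Prime) (hqr : q ≠ r) (R : Sylow r G) {b : G}
      (hb : b ∈ R) : q.Coprime (orderOf b) := by
    simpa using (R.2.orderOf_coprime ((Nat.coprime_primes hr hq).mpr hqr.symm) ⟨b, hb⟩).symm
  have hnormal {q : ℕ} [Fact q.Prime] (hqp : q ≠ p) (Q : Sylow q G) : (Q : Subgroup G).Normal :=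
    Q.normal_of_le_of_isNilpotent fun b hb ↦ mem_centralizer_iff.mpr fun x hx ↦
      hcomm p P inferInstance hP x hx b (hcop hp Fact.out hqp.symm Q hb)
  refine (Group.isNilpotent_of_finite_tfae.out 0 3 rfl rfl).mpr fun q hq S ↦ ?_
  by_cases hqp : q = p
  swap
  · exact hnormal hqp S
  subst hqp
  rw [← normalizer_eq_top_iff, ← index_eq_one]
  by_contra hne
  obtain ⟨r, hr, hrd⟩ := Nat.exists_prime_and_dvd hne
  have : Fact r.Prime := ⟨hr⟩
  by_cases hrq : r = q
  · subst hrq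
    exact S.not_dvd_index (hrd.trans (index_dvd_of_le le_normalizer))
  · obtain ⟨R⟩ : Nonempty (Sylow r G) := inferInstance
    refine R.not_dvd_index (hrd.trans (index_dvd_of_le fun x hx ↦ ?_))
    refine centralizer_le_normalizer _ (mem_centralizer_iff.mpr fun b hb ↦ ?_)
    exact (hcomm r R (hnormal hrq R) R.2 x hx b (hcop hr hp hrq S hb)).eq.symm

open Subgroup in
theorem isNilpotent_of_gammaStar_subset_one {G : Type*} [Group G] [Finite G] {k : ℕ}
    (hk : 2 ≤ k) (h : gammaStar G k ⊆ {1}) : Group.IsNilpotent G := by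
  induction hn : Nat.card G using Nat.strong_induction_on generalizing G with
  | _ n ih =>
    have hnil (H : Subgroup G) (hH : H ≠ ⊤) : Group.IsNilpotent H := by
      refine ih (Nat.card H) ?_ (fun x hx ↦ ?_) rfl
      · rw [← hn]
        exact lt_of_le_of_ne (card_le_card_group H) (mt (eq_top_of_card_eq H) hH)
      · simpa using h (map_mem_gammaStar H.subtype_injective hx)
    by_contra hG
    obtain ⟨N, hN, hN1, hN2⟩ := exists_normal_of_forall_isNilpotent hnil hG
    have := hnil N hN2
    obtain ⟨p, hp, P, hPn, hP, hP1⟩ := exists_normal_isPGroup_of_isNilpotent hN1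
    by_cases hC : centralizer (P : Set G) = ⊤
    · refine hG (Group.of_quotient_center_nilpotent (ih _ ?_ (fun y hy ↦ ?_) rfl))
      · have hZ : 1 < Nat.card (center G) := one_lt_card_iff_ne_bot _ |>.mpr
          (ne_bot_of_le_ne_bot hP1 (centralizer_eq_top_iff_subset.mp hC))
        rw [← hn, card_eq_card_quotient_mul_card_subgroup (center G)]
        exact lt_mul_of_one_lt_right Nat.card_pos hZ
      · obtain ⟨x, hx, rfl⟩ :=
          exists_mem_gammaStar_map_eq (QuotientGroup.mk'_surjective (center G)) hy
        rw [h hx, map_one]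
        rfl
    · refine hG (isNilpotent_of_isNilpotent_centralizer ?_ hp hP (hnil _ hC))
      intro q Q hQ hq x hx b hb
      exact commute_of_gammaStar_subset_one hk h hq hx hb

/-- For a finite group `G` and `k ≥ 2`, `γ_k*(G) = 1` iff `G` is nilpotent. -/
theorem gammaStar_eq_bot_iff_nilpotent (G : Type*) [Group G] [Finite G]
    (k : ℕ) (hk : 2 ≤ k) :
    Subgroup.closure (gammaStar G k) = ⊥ ↔ Group.IsNilpotent G := by
  rw [Subgroup.closure_eq_bot_iff]
  exact ⟨isNilpotent_of_gammaStar_subset_one hk,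
    fun _ ↦ gammaStar_subset_one_of_isNilpotent G hk⟩
end

section
/- For n ≥ 5, every element of the alternating group A_n is a commutator [y,b] where y, b ∈ A_n, y has odd order, and the order of b divides 4. -/
open Equiv Equiv.Perm

variable {α : Type*} [Fintype α] [DecidableEq α]

/-- `x = [y, b]` where `y` has odd order, `b ^ 4 = 1`, `b` has sign `s`, and `y` and `b` move only
points moved by `x`. -/
structure IsCommWitness (x y b : Perm α) (s : ℤˣ) : Prop where
  eq : x = y⁻¹ * b⁻¹ * y * b
  odd : Odd (orderOf y)
  pow : b ^ 4 = 1
  sign : sign b = s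
  supp_y : y.support ⊆ x.support
  supp_b : b.support ⊆ x.support

/-- `x` is a commutator `[y, b]` as in `IsCommWitness`. -/
def IsComm (x : Perm α) (s : ℤˣ) : Prop := ∃ y b, IsCommWitness x y b s

theorem isComm_one : IsComm (1 : Perm α) 1 :=
  ⟨1, 1, by simp, by simp, by simp, by simp, by simp, by simp⟩

theorem IsComm.conj {x : Perm α} {s : ℤˣ} (h : IsComm x s) (g : Perm α) :
    IsComm (g * x * g⁻¹) s := by
  obtain ⟨y, b, h⟩ := h
  refine ⟨g * y * g⁻¹, g * b * g⁻¹, ?_, ?_, ?_, ?_, ?_, ?_⟩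
  · rw [h.eq]; group
  · have : orderOf (g * y * g⁻¹) = orderOf y :=
      orderOf_injective (MulAut.conj g).toMonoidHom (MulAut.conj g).injective y
    rw [this]; exact h.odd
  · rw [conj_pow, h.pow]; simp
  · rw [map_mul, map_mul, mul_comm (Perm.sign g), mul_assoc, ← map_mul, mul_inv_cancel, map_one,
      mul_one, h.sign]
  · simpa [support_conj] using h.supp_y
  · simpa [support_conj] using h.supp_b

theorem IsComm.of_cycleType_eq {x x' : Perm α} {s : ℤˣ} (h : IsComm x s)
    (hx : x'.cycleType = x.cycleType) : IsComm x' s := by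
  obtain ⟨g, rfl⟩ := isConj_iff.1 (isConj_iff_cycleType_eq.2 hx.symm)
  exact h.conj g

theorem IsComm.mul {x x' : Perm α} {s s' : ℤˣ} (h : IsComm x s) (h' : IsComm x' s')
    (hd : Disjoint x x') : IsComm (x * x') (s * s') := by
  obtain ⟨y, b, h⟩ := h
  obtain ⟨y', b', h'⟩ := h'
  have hyy : Disjoint y y' := hd.mono h.supp_y h'.supp_y
  have hbb : Disjoint b b' := hd.mono h.supp_b h'.supp_b
  have hyb : Disjoint y b' := hd.mono h.supp_y h'.supp_b
  have hby : Disjoint b y' := hd.mono h.supp_b h'.supp_y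
  refine ⟨y * y', b * b', ?_, ?_, ?_, ?_, ?_, ?_⟩
  · rw [h.eq, h'.eq]
    have e1 : b * (y'⁻¹ * b'⁻¹ * y') = (y'⁻¹ * b'⁻¹ * y') * b :=
      ((hby.commute.inv_right.mul_right hbb.commute.inv_right).mul_right hby.commute).eq
    have e2 : (y * y')⁻¹ = y⁻¹ * y'⁻¹ := by rw [hyy.commute.mul_inv]
    have e3 : (b * b')⁻¹ = b⁻¹ * b'⁻¹ := by rw [hbb.commute.mul_inv]
    have e4 : y'⁻¹ * b⁻¹ = b⁻¹ * y'⁻¹ := hby.commute.symm.inv_inv.eq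
    have e5 : (y'⁻¹ * b'⁻¹) * y = y * (y'⁻¹ * b'⁻¹) :=
      (hyy.commute.symm.inv_left.mul_left hyb.commute.symm.inv_left).eq
    calc y⁻¹ * b⁻¹ * y * b * (y'⁻¹ * b'⁻¹ * y' * b')
        = y⁻¹ * b⁻¹ * y * (b * (y'⁻¹ * b'⁻¹ * y')) * b' := by group
      _ = y⁻¹ * b⁻¹ * (y * (y'⁻¹ * b'⁻¹)) * y' * b * b' := by rw [e1]; group
      _ = y⁻¹ * (b⁻¹ * y'⁻¹) * b'⁻¹ * y * y' * b * b' := by rw [← e5]; group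
      _ = _ := by rw [← e4, e2, e3]; group
  · rw [hyy.orderOf]
    exact (h.odd.mul h'.odd).of_dvd_nat (Nat.lcm_dvd_mul _ _)
  · rw [hbb.commute.mul_pow, h.pow, h'.pow, one_mul]
  · rw [map_mul, h.sign, h'.sign]
  · rw [hd.support_mul, hyy.support_mul]; exact Finset.union_subset_union h.supp_y h'.supp_y
  · rw [hd.support_mul, hbb.support_mul]; exact Finset.union_subset_union h.supp_b h'.supp_b

theorem IsComm.mul_forall {x x' : Perm α} {s' : ℤˣ} (h : ∀ s, IsComm x s) (h' : IsComm x' s')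
    (hd : Disjoint x x') (s : ℤˣ) : IsComm (x * x') s := by
  simpa [mul_assoc] using (h (s * s'⁻¹)).mul h' hd

theorem IsCommWitness.extendDomain {β : Type*} [Fintype β] [DecidableEq β] {x y b : Perm β}
    {s : ℤˣ} (h : IsCommWitness x y b s) {p : α → Prop} [DecidablePred p] (f : β ≃ Subtype p) :
    IsCommWitness (x.extendDomain f) (y.extendDomain f) (b.extendDomain f) s where
  eq := by simp [extendDomain_mul, extendDomain_inv, h.eq]
  odd := by
    have : orderOf (y.extendDomain f) = orderOf y :=
      orderOf_injective (extendDomainHom f) (extendDomainHom_injective f) y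
    rw [this]; exact h.odd
  pow := by rw [← extendDomain_pow, h.pow, extendDomain_one]
  sign := by rw [sign_extendDomain, h.sign]
  supp_y := by simpa [support_extend_domain] using h.supp_y
  supp_b := by simpa [support_extend_domain] using h.supp_b

theorem exists_equiv_subtype {β : Type*} [Fintype β] {k : ℕ} (h : k ≤ Fintype.card β) :
    ∃ s : Finset β, Nonempty (Fin k ≃ {a // a ∈ s}) := by
  obtain ⟨s, -, hs⟩ := Finset.exists_subset_card_eq (s := (Finset.univ : Finset β)) h
  exact ⟨s, ⟨(Finset.equivFinOfCardEq hs).symm⟩⟩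

theorem IsCommWitness.isComm {k : ℕ} {x y b : Perm (Fin k)} {s : ℤˣ} (h : IsCommWitness x y b s)
    {x' : Perm α} (hx : x'.cycleType = x.cycleType) (hk : x.support.card = k) : IsComm x' s := by
  have : k ≤ Fintype.card α := by
    rw [← hk, ← sum_cycleType, ← hx]; exact sum_cycleType_le x'
  obtain ⟨t, ⟨f⟩⟩ := exists_equiv_subtype this
  exact IsComm.of_cycleType_eq ⟨_, _, h.extendDomain f⟩ (by rw [hx, cycleType_extendDomain])

theorem isCycle_swap_mul {σ : Perm α} (hσ : σ.IsCycle) {a p : α} (ha : a ∈ σ.support)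
    (hp : p ∉ σ.support) :
    (swap a p * σ).IsCycle ∧ (swap a p * σ).support = insert p σ.support := by
  have hf : (toList σ a).formPerm = σ := by
    rw [formPerm_toList, hσ.cycleOf_eq (mem_support.1 ha)]
  have hn := nodup_toList σ a
  have hl := two_le_length_toList_iff_mem_support.2 ha
  have h0 (h : 0 < (toList σ a).length) : (toList σ a)[0] = a := toList_getElem_zero σ a ha
  have hs : σ.support = (toList σ a).toFinset := by
    conv_lhs => rw [← hf]
    exact List.support_formPerm_of_nodup _ hn (fun y => toList_ne_singleton σ a y)
  generalize toList σ a = l at *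
  obtain _ | ⟨a', l⟩ := l
  · simp at hl
  obtain rfl : a' = a := by simpa using h0
  have he : swap a' p * σ = List.formPerm (p :: a' :: l) := by
    rw [List.formPerm_cons_cons, hf, swap_comm]
  have hn' : (p :: a' :: l).Nodup := by
    rw [List.nodup_cons]; exact ⟨by simpa [hs] using hp, hn⟩
  rw [he]
  refine ⟨List.isCycle_formPerm hn' (by simp), ?_⟩
  rw [List.support_formPerm_of_nodup _ hn' (by simp), hs]
  simp

theorem isCycle_swap_mul_swap_mul {σ : Perm α} (hσ : σ.IsCycle) {a c p q : α} (ha : a ∈ σ.support)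
    (hc : c ∈ σ.support) (hp : p ∉ σ.support) (hq : q ∉ σ.support) (hpq : p ≠ q) :
    (swap c q * (swap a p * σ)).IsCycle ∧
      (swap c q * (swap a p * σ)).support = insert q (insert p σ.support) := by
  obtain ⟨h1, h2⟩ := isCycle_swap_mul hσ ha hp
  obtain ⟨h3, h4⟩ := isCycle_swap_mul h1 (a := c) (p := q) (by simp [h2, hc])
    (by simp [h2, hq, hpq.symm])
  exact ⟨h3, by rw [h4, h2]⟩

theorem odd_orderOf_mul_swap_mul_swap {y : Perm α} (hy : Odd (orderOf y)) {a p q : α}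
    (hp : p ∉ y.support) (hq : q ∉ y.support) (hap : a ≠ p) (haq : a ≠ q) (hpq : p ≠ q) :
    Odd (orderOf (y * (swap a q * swap a p))) := by
  have hcomm : orderOf (y * (swap a q * swap a p)) = orderOf (swap a q * swap a p * y) := by
    have : orderOf (MulAut.conj y (swap a q * swap a p * y)) = orderOf (swap a q * swap a p * y) :=
      orderOf_injective (MulAut.conj y).toMonoidHom (MulAut.conj y).injective _
    rw [← this]; congr 1; simp [mul_assoc]
  rw [hcomm]
  by_cases ha : a ∈ y.support
  · set c := y.cycleOf a
    have hc : c.IsCycle := isCycle_cycleOf y (mem_support.1 ha)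
    have hcf : c ∈ y.cycleFactorsFinset := cycleOf_mem_cycleFactorsFinset_iff.2 ha
    have hd : Disjoint c (y * c⁻¹) := (disjoint_mul_inv_of_mem_cycleFactorsFinset hcf).symm
    have hyc : y = c * (y * c⁻¹) := by rw [hd.commute.eq]; group
    have hs : y.support = c.support ∪ (y * c⁻¹).support := by
      conv_lhs => rw [hyc]
      exact hd.support_mul
    generalize y * c⁻¹ = r at *
    have hac : a ∈ c.support := mem_support_cycleOf_iff.2 ⟨SameCycle.refl _ _, ha⟩
    rw [hyc, hd.orderOf, hc.orderOf] at hy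
    rw [hs, Finset.mem_union, not_or] at hp hq
    obtain ⟨h1, h2⟩ := isCycle_swap_mul_swap_mul hc hac hac hp.1 hq.1 hpq
    have hd' : Disjoint (swap a q * (swap a p * c)) r := by
      rw [disjoint_iff_disjoint_support, h2, Finset.disjoint_insert_left,
        Finset.disjoint_insert_left]
      exact ⟨hq.2, hp.2, hd.disjoint_support⟩
    have : swap a q * swap a p * y = swap a q * (swap a p * c) * r := by
      rw [hyc]; simp only [mul_assoc]
    rw [this, hd'.orderOf, h1.orderOf, h2, Finset.card_insert_of_notMem (by simp [hq.1, hpq.symm]),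
      Finset.card_insert_of_notMem hp.1]
    have ho1 := hy.of_dvd_nat (Nat.dvd_lcm_left _ _)
    have ho2 := hy.of_dvd_nat (Nat.dvd_lcm_right _ _)
    exact ((ho1.add_even even_two).mul ho2).of_dvd_nat (Nat.lcm_dvd_mul _ _)
  · have h3 : (swap a q * swap a p).IsThreeCycle := isThreeCycle_swap_mul_swap_same haq hap hpq.symm
    have hd : Disjoint (swap a q * swap a p) y := by
      rw [disjoint_iff_disjoint_support, Finset.disjoint_left]
      intro w hw hwy
      have h1 : w ≠ a := by rintro rfl; exact ha hwy
      have h2 : w ≠ p := by rintro rfl; exact hp hwy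
      have h3 : w ≠ q := by rintro rfl; exact hq hwy
      simp [swap_apply_of_ne_of_ne, h1, h2, h3] at hw
    rw [hd.orderOf, h3.orderOf]
    exact (Odd.mul (by decide : Odd 3) hy).of_dvd_nat (Nat.lcm_dvd_mul _ _)

/-- A witness that `x₁ * x₂` is a commutator `[y, b]`, where `x₁` is a cycle, `x₂` is trivial or a
disjoint cycle, and `b` sends some point of each of these cycles into the same cycle. -/
structure IsGrowable (x₁ x₂ y b : Perm α) (s : ℤˣ) : Prop where
  witness : IsCommWitness (x₁ * x₂) y b s
  isCycle : x₁.IsCycle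
  disjoint : Disjoint x₁ x₂
  mark : ∃ c ∈ x₁.support, b c ∈ x₁.support
  isCycle' : x₂ = 1 ∨ x₂.IsCycle ∧ ∃ c ∈ x₂.support, b c ∈ x₂.support

variable (α) in
/-- There is a growable commutator with cycles of lengths `m₁` and `m₂`, where `m₂ = 0` means
that the second cycle is absent. -/
def GrowableType (m₁ m₂ : ℕ) (s : ℤˣ) : Prop :=
  ∃ x₁ x₂ y b : Perm α, IsGrowable x₁ x₂ y b s ∧ x₁.support.card = m₁ ∧ x₂.support.card = m₂

theorem GrowableType.symm {m₁ m₂ : ℕ} {s : ℤˣ} (h : GrowableType α m₁ m₂ s) (hm : m₂ ≠ 0) :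
    GrowableType α m₂ m₁ s := by
  obtain ⟨x₁, x₂, y, b, h, rfl, rfl⟩ := h
  have h2 := h.isCycle'.resolve_left (by rintro rfl; simp at hm)
  exact ⟨x₂, x₁, y, b, ⟨h.disjoint.commute.eq ▸ h.witness, h2.1, h.disjoint.symm, h2.2,
    .inr ⟨h.isCycle, h.mark⟩⟩, rfl, rfl⟩

theorem commutator_mul_mul_of_commute {G : Type*} [Group G] {y b t u : G}
    (hy : Commute y u) (hb : Commute b u) :
    (y * t)⁻¹ * (b * u)⁻¹ * (y * t) * (b * u) =
      ((b * u)⁻¹ * t * (b * u))⁻¹ * (((b * u)⁻¹ * t * (b * u)) * t⁻¹ * (y⁻¹ * b⁻¹ * y * b)) *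
        ((b * u)⁻¹ * t * (b * u)) := by
  calc (y * t)⁻¹ * (b * u)⁻¹ * (y * t) * (b * u)
      = t⁻¹ * y⁻¹ * (b * u)⁻¹ * y * t * b * u := by group
    _ = t⁻¹ * y⁻¹ * b⁻¹ * (y * u⁻¹) * t * b * u := by
      rw [hb.eq, hy.inv_right.eq]; group
    _ = t⁻¹ * y⁻¹ * b⁻¹ * y * b * (u * b)⁻¹ * t * b * u := by group
    _ = _ := by rw [← hb.eq]; group

theorem disjoint_swap_of_notMem_support {y : Perm α} {p q : α} (hp : p ∉ y.support)
    (hq : q ∉ y.support) : Disjoint y (swap p q) := by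
  intro w
  by_cases h1 : w = p
  · left; rw [h1]; exact notMem_support.1 hp
  by_cases h2 : w = q
  · left; rw [h2]; exact notMem_support.1 hq
  · right; exact swap_apply_of_ne_of_ne h1 h2

theorem exists_ne_notMem_of_card_add_two_le {T : Finset α} (h : T.card + 2 ≤ Fintype.card α) :
    ∃ p q, p ∉ T ∧ q ∉ T ∧ p ≠ q := by
  have : 1 < Tᶜ.card := by rw [Finset.card_compl]; lia
  obtain ⟨p, hp, q, hq, hpq⟩ := Finset.one_lt_card.1 this
  exact ⟨p, q, by simpa using hp, by simpa using hq, hpq⟩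

theorem GrowableType.add_two {m₁ m₂ : ℕ} {s : ℤˣ} (h : GrowableType α m₁ m₂ s)
    (hm : m₁ + m₂ + 2 ≤ Fintype.card α) : GrowableType α (m₁ + 2) m₂ (-s) := by
  obtain ⟨x₁, x₂, y, b, h, rfl, rfl⟩ := h
  obtain ⟨c, hc, hbc⟩ := h.mark
  have hw := h.witness
  have hsupp := h.disjoint.support_mul
  obtain ⟨p, q, hp, hq, hpq⟩ : ∃ p q, p ∉ (x₁ * x₂).support ∧ q ∉ (x₁ * x₂).support ∧ p ≠ q :=
    exists_ne_notMem_of_card_add_two_le (by rwa [h.disjoint.card_support_mul])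
  have hpy := fun h' => hp (hw.supp_y h')
  have hqy := fun h' => hq (hw.supp_y h')
  have hpb := fun h' => hp (hw.supp_b h')
  have hqb := fun h' => hq (hw.supp_b h')
  rw [hsupp, Finset.mem_union, not_or] at hp hq
  have hcp : c ≠ p := by rintro rfl; exact hp.1 hc
  have hcq : c ≠ q := by rintro rfl; exact hq.1 hc
  have hap : b c ≠ p := by intro h; rw [h] at hbc; exact hp.1 hbc
  have haq : b c ≠ q := by intro h; rw [h] at hbc; exact hq.1 hbc
  have hcx₂ : c ∉ x₂.support := h.disjoint.mem_imp hc
  set a := b c with ha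
  set t := swap a q * swap a p with ht
  set u := swap p q with hu
  set z := swap c p * swap c q with hz
  have hbu : Disjoint b u := disjoint_swap_of_notMem_support hpb hqb
  have hyu : Disjoint y u := disjoint_swap_of_notMem_support hpy hqy
  have hzt : (b * u)⁻¹ * t * (b * u) = z := by
    have e1 : (b * u) c = a := by simp [u, swap_apply_of_ne_of_ne hcp hcq, ha]
    have e2 : (b * u) p = q := by simpa [u] using hqb
    have e3 : (b * u) q = p := by simpa [u] using hpb
    have : t * (b * u) = (b * u) * z := by
      generalize b * u = v at e1 e2 e3 ⊢
      rw [ht, hz, ← mul_assoc v, mul_swap_eq_swap_mul v, mul_assoc _ v, mul_swap_eq_swap_mul v,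
        e1, e2, e3, mul_assoc]
    rw [mul_assoc, this]; group
  have hzt' : z * t⁻¹ = swap c q * swap a p := by
    rw [hz, ht, mul_inv_rev, swap_inv, swap_inv]
    ext w
    simp only [Perm.mul_apply, swap_apply_def]
    grind
  obtain ⟨hX, hXs⟩ := isCycle_swap_mul_swap_mul h.isCycle hbc hc hp.1 hq.1 hpq
  set X := swap c q * (swap a p * x₁) with hXdef
  have hzX : ∀ w, w ∈ (z⁻¹ * X * z).support ↔ w ∈ insert q (insert p x₁.support) := by
    intro w
    have : (z⁻¹ * X * z) w ≠ w ↔ X (z w) ≠ z w := by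
      rw [Perm.mul_apply, Perm.mul_apply, Ne, Perm.inv_eq_iff_eq]
    rw [mem_support, this, ← mem_support, hXs, hz]
    simp only [Perm.mul_apply, swap_apply_def]
    grind
  have hzX' : (z⁻¹ * X * z).support = insert q (insert p x₁.support) := Finset.ext hzX
  have hzx₂ : Disjoint z x₂ := by
    intro w
    by_cases h1 : w ∈ x₂.support
    · left
      have h2 : w ≠ p := by rintro rfl; exact hp.2 h1
      have h3 : w ≠ q := by rintro rfl; exact hq.2 h1
      have h4 : w ≠ c := by rintro rfl; exact hcx₂ h1
      simp [hz, swap_apply_of_ne_of_ne, h2, h3, h4]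
    · right; exact notMem_support.1 h1
  have hd : Disjoint (z⁻¹ * X * z) x₂ := by
    rw [disjoint_iff_disjoint_support, hzX', Finset.disjoint_insert_left,
        Finset.disjoint_insert_left]
    exact ⟨hq.2, hp.2, h.disjoint.disjoint_support⟩
  have hsub : (x₁ * x₂).support ⊆ (z⁻¹ * X * z * x₂).support := by
    rw [hd.support_mul, hsupp, hzX']
    exact Finset.union_subset_union
      ((Finset.subset_insert _ _).trans (Finset.subset_insert _ _)) subset_rfl
  have haT : a ∈ (z⁻¹ * X * z * x₂).support := hsub (by simp [hsupp, hbc])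
  have hpT : p ∈ (z⁻¹ * X * z * x₂).support := by simp [hd.support_mul, hzX']
  have hqT : q ∈ (z⁻¹ * X * z * x₂).support := by simp [hd.support_mul, hzX']
  have hswap {v w : α} {T : Finset α} (hv : v ∈ T) (hw : w ∈ T) : (swap v w).support ⊆ T := by
    intro r hr
    by_contra hrT
    exact mem_support.1 hr (swap_apply_of_ne_of_ne (by grind) (by grind))
  have hbu_apply {w : α} (h1 : w ≠ p) (h2 : w ≠ q) : (b * u) w = b w := by
    simp [u, swap_apply_of_ne_of_ne h1 h2]
  refine ⟨z⁻¹ * X * z, x₂, y * t, b * u, ⟨⟨?_, ?_, ?_, ?_, ?_, ?_⟩, ?_, hd, ?_, ?_⟩, ?_, rfl⟩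
  · rw [commutator_mul_mul_of_commute hyu.commute hbu.commute, hzt, hzt', ← hw.eq, hXdef,
      mul_assoc _ z, hzx₂.commute.eq]
    group
  · exact odd_orderOf_mul_swap_mul_swap hw.odd hpy hqy hap haq hpq
  · rw [hbu.commute.mul_pow, hw.pow, hu, pow_succ, pow_succ, pow_succ]; simp
  · rw [map_mul, hw.sign, hu, sign_swap hpq]; simp
  · exact (support_mul_le _ _).trans (Finset.union_subset (hw.supp_y.trans hsub)
      ((support_mul_le _ _).trans (Finset.union_subset (hswap haT hqT) (hswap haT hpT))))
  · exact (support_mul_le _ _).trans (Finset.union_subset (hw.supp_b.trans hsub) (hswap hpT hqT))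
  · have := hX.conj (g := z⁻¹)
    rwa [inv_inv] at this
  · refine ⟨c, (hzX c).2 (by simp [hc]), ?_⟩
    rw [hzX, hbu_apply hcp hcq]; simp [hbc, ← ha]
  · refine h.isCycle'.imp_right fun ⟨h1, c', hc', hbc'⟩ => ⟨h1, c', hc', ?_⟩
    rwa [hbu_apply]
    · rintro rfl; exact hp.2 hc'
    · rintro rfl; exact hq.2 hc'
  · rw [hzX', Finset.card_insert_of_notMem (by simp [hq.1, hpq.symm]),
      Finset.card_insert_of_notMem hp.1]

theorem GrowableType.isComm {m₁ m₂ : ℕ} {s : ℤˣ} (h : GrowableType α m₁ m₂ s) {x₁ x₂ : Perm α}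
    (h₁ : x₁.IsCycle) (h₂ : x₂.IsCycle) (hd : Disjoint x₁ x₂) (hm₁ : x₁.support.card = m₁)
    (hm₂ : x₂.support.card = m₂) : IsComm (x₁ * x₂) s := by
  obtain ⟨z₁, z₂, y, b, h, rfl, rfl⟩ := h
  refine IsComm.of_cycleType_eq ⟨y, b, h.witness⟩ ?_
  have h2 := h.isCycle'.resolve_left (by
    rintro rfl; exact h₂.ne_one (card_support_eq_zero.1 (hm₂.trans (by simp))))
  rw [hd.cycleType_mul, h.disjoint.cycleType_mul, h₁.cycleType, h₂.cycleType, h2.1.cycleType,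
    h.isCycle.cycleType, hm₁, hm₂]

theorem GrowableType.isComm_of_isCycle {m : ℕ} {s : ℤˣ} (h : GrowableType α m 0 s) {x : Perm α}
    (hx : x.IsCycle) (hm : x.support.card = m) : IsComm x s := by
  obtain ⟨z₁, z₂, y, b, h, rfl, h0⟩ := h
  obtain rfl : z₂ = 1 := by simpa using h0
  refine IsComm.of_cycleType_eq ⟨y, b, h.witness⟩ ?_
  rw [mul_one, hx.cycleType, h.isCycle.cycleType, hm]

theorem GrowableType.of_fin {k m₁ m₂ : ℕ} {s : ℤˣ} (h : GrowableType (Fin k) m₁ m₂ s)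
    (hk : k ≤ Fintype.card α) : GrowableType α m₁ m₂ s := by
  obtain ⟨t, ⟨f⟩⟩ := exists_equiv_subtype hk
  obtain ⟨x₁, x₂, y, b, h, rfl, rfl⟩ := h
  have hmark {x : Perm (Fin k)} (h : ∃ c ∈ x.support, b c ∈ x.support) :
      ∃ c ∈ (x.extendDomain f).support, b.extendDomain f c ∈ (x.extendDomain f).support := by
    obtain ⟨c, hc, hbc⟩ := h
    refine ⟨f c, ?_, ?_⟩
    · rw [mem_support, extendDomain_apply_image]
      simpa [Subtype.coe_inj] using hc
    · rw [mem_support, extendDomain_apply_image, extendDomain_apply_image]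
      simpa [Subtype.coe_inj] using hbc
  refine ⟨x₁.extendDomain f, x₂.extendDomain f, y.extendDomain f, b.extendDomain f,
    ⟨?_, h.isCycle.extendDomain f, h.disjoint.extendDomain f, hmark h.mark, ?_⟩,
    card_support_extend_domain f, card_support_extend_domain f⟩
  · rw [extendDomain_mul]; exact h.witness.extendDomain f
  · exact h.isCycle'.imp (fun h => by rw [h, extendDomain_one])
      fun h => ⟨h.1.extendDomain f, hmark h.2⟩

theorem odd_orderOf_of_pow_eq_one {G : Type*} [Monoid G] {y : G} {m : ℕ} (hm : Odd m)
    (h : y ^ m = 1) : Odd (orderOf y) :=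
  hm.of_dvd_nat (orderOf_dvd_of_pow_eq_one h)

theorem growableType_three : GrowableType (Fin 3) 3 0 (-1) := by
  refine ⟨List.formPerm [0, 1, 2], 1, List.formPerm [0, 1, 2], swap 1 2,
    ⟨⟨by decide, odd_orderOf_of_pow_eq_one (m := 3) (by decide) (by decide), by decide, by decide,
      by decide, by decide⟩, List.isCycle_formPerm (by decide) (by decide),
      disjoint_one_right _, by decide, .inl rfl⟩, by decide, by decide⟩

set_option maxRecDepth 4000 in
theorem growableType_five (s : ℤˣ) : GrowableType (Fin 5) 5 0 s := by
  obtain rfl | rfl := Int.units_eq_one_or s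
  · exact ⟨List.formPerm [0, 1, 2, 3, 4], 1, List.formPerm [0, 1, 4, 2, 3], swap 1 4 * swap 2 3,
      ⟨⟨by decide, odd_orderOf_of_pow_eq_one (m := 5) (by decide) (by decide), by decide, by decide,
        by decide, by decide⟩, List.isCycle_formPerm (by decide) (by decide),
        disjoint_one_right _, by decide, .inl rfl⟩, by decide, by decide⟩
  · exact ⟨List.formPerm [0, 1, 2, 3, 4], 1, List.formPerm [0, 3, 1, 4, 2],
      List.formPerm [1, 2, 4, 3],
      ⟨⟨by decide, odd_orderOf_of_pow_eq_one (m := 5) (by decide) (by decide), by decide, by decide,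
        by decide, by decide⟩, List.isCycle_formPerm (by decide) (by decide),
        disjoint_one_right _, by decide, .inl rfl⟩, by decide, by decide⟩

set_option maxRecDepth 4000 in
theorem growableType_two_four (s : ℤˣ) : GrowableType (Fin 6) 2 4 s := by
  obtain rfl | rfl := Int.units_eq_one_or s
  · exact ⟨List.formPerm [0, 1], List.formPerm [2, 3, 4, 5], List.formPerm [0, 2, 5, 1, 3],
      swap 2 3 * swap 4 5,
      ⟨⟨by decide, odd_orderOf_of_pow_eq_one (m := 5) (by decide) (by decide), by decide, by decide,
        by decide, by decide⟩, List.isCycle_formPerm (by decide) (by decide),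
        by unfold Perm.Disjoint; decide, by decide,
        .inr ⟨List.isCycle_formPerm (by decide) (by decide), by decide⟩⟩, by decide, by decide⟩
  · exact ⟨List.formPerm [0, 1], List.formPerm [2, 3, 4, 5], List.formPerm [0, 1, 4, 5, 3],
      List.formPerm [1, 2, 3, 4],
      ⟨⟨by decide, odd_orderOf_of_pow_eq_one (m := 5) (by decide) (by decide), by decide, by decide,
        by decide, by decide⟩, List.isCycle_formPerm (by decide) (by decide),
        by unfold Perm.Disjoint; decide, by decide,
        .inr ⟨List.isCycle_formPerm (by decide) (by decide), by decide⟩⟩, by decide, by decide⟩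

theorem isComm_of_card_support_eq_three {x : Perm α} (h : x.support.card = 3) :
    IsComm x (-1) := by
  have h3 := card_support_eq_three_iff.1 h
  exact (growableType_three.of_fin (h ▸ Finset.card_le_univ _)).isComm_of_isCycle h3.isCycle h

theorem growableType_odd (k : ℕ) (s : ℤˣ) (hk : 5 + 2 * k ≤ Fintype.card α) :
    GrowableType α (5 + 2 * k) 0 s := by
  induction k generalizing s with
  | zero => exact (growableType_five s).of_fin (by simpa using hk)
  | succ k ih => simpa [mul_add, add_assoc] using (ih (-s) (by lia)).add_two (by lia)

theorem growableType_even (j k : ℕ) (s : ℤˣ) (h : 2 + 2 * j + (4 + 2 * k) ≤ Fintype.card α) :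
    GrowableType α (2 + 2 * j) (4 + 2 * k) s := by
  induction j generalizing s with
  | zero =>
    refine GrowableType.symm ?_ (by simp)
    induction k generalizing s with
    | zero => exact ((growableType_two_four s).symm (by simp)).of_fin (by simpa using h)
    | succ k ih => simpa [mul_add, add_assoc] using (ih (-s) (by lia)).add_two (by lia)
  | succ j ih => simpa [mul_add, add_assoc] using (ih (-s) (by lia)).add_two (by lia)

theorem isComm_of_odd_card_support {x : Perm α} (hx : x.IsCycle) (ho : Odd x.support.card)
    (h3 : x.support.card ≠ 3) (s : ℤˣ) : IsComm x s := by
  obtain ⟨k, hk⟩ : ∃ k, x.support.card = 5 + 2 * k := by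
    obtain ⟨k, hk⟩ := ho
    have := hx.two_le_card_support
    exact ⟨k - 2, by lia⟩
  exact (growableType_odd k s (hk ▸ Finset.card_le_univ _)).isComm_of_isCycle hx hk

theorem isComm_mul_of_even_card_support {x₁ x₂ : Perm α} (h₁ : x₁.IsCycle) (h₂ : x₂.IsCycle)
    (hd : Disjoint x₁ x₂) (he₁ : Even x₁.support.card) (he₂ : Even x₂.support.card)
    (h : ¬ (x₁.support.card = 2 ∧ x₂.support.card = 2)) (s : ℤˣ) : IsComm (x₁ * x₂) s := by
  wlog h4 : x₂.support.card ≠ 2 generalizing x₁ x₂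
  · rw [hd.commute.eq]
    exact this h₂ h₁ hd.symm he₂ he₁ (by tauto) (by tauto)
  have hc : x₁.support.card + x₂.support.card ≤ Fintype.card α := by
    rw [← hd.card_support_mul]; exact Finset.card_le_univ _
  have t₁ := h₁.two_le_card_support
  have t₂ := h₂.two_le_card_support
  obtain ⟨j, hj⟩ := he₁
  obtain ⟨k, hk⟩ := he₂
  have hj' : x₁.support.card = 2 + 2 * (j - 1) := by lia
  have hk' : x₂.support.card = 4 + 2 * (k - 2) := by lia
  exact (growableType_even (j - 1) (k - 2) s (by lia)).isComm h₁ h₂ hd hj' hk'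

theorem cycleType_formPerm {l : List α} (h : l.Nodup) (h2 : 2 ≤ l.length) :
    l.formPerm.cycleType = {l.length} := by
  rw [(List.isCycle_formPerm h h2).cycleType, List.support_formPerm_of_nodup l h,
    List.toFinset_card_of_nodup h]
  rintro x rfl
  simp at h2

theorem isComm_of_cycleType_eq_two_two {x : Perm α} (hx : x.cycleType = {2, 2}) : IsComm x 1 := by
  have h : IsCommWitness (List.formPerm [0, 1] * List.formPerm [2, 3] : Perm (Fin 4))
      (List.formPerm [1, 3, 2]) (swap 0 2 * swap 1 3) 1 :=
    ⟨by decide, odd_orderOf_of_pow_eq_one (m := 3) (by decide) (by decide), by decide, by decide,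
      by decide, by decide⟩
  refine h.isComm ?_ (by decide)
  rw [Disjoint.cycleType_mul (by unfold Perm.Disjoint; decide), hx,
    cycleType_formPerm (by decide) (by decide), cycleType_formPerm (by decide) (by decide)]
  rfl

set_option maxRecDepth 4000 in
theorem isComm_of_cycleType_eq_three_three {x : Perm α} (hx : x.cycleType = {3, 3}) (s : ℤˣ) :
    IsComm x s := by
  have ht : x.cycleType =
      (List.formPerm [0, 1, 2] * List.formPerm [3, 4, 5] : Perm (Fin 6)).cycleType := by
    rw [Disjoint.cycleType_mul (by unfold Perm.Disjoint; decide), hx,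
      cycleType_formPerm (by decide) (by decide), cycleType_formPerm (by decide) (by decide)]
    rfl
  obtain rfl | rfl := Int.units_eq_one_or s
  · exact IsCommWitness.isComm (y := List.formPerm [0, 1, 2] * List.formPerm [3, 4, 5])
      (b := swap 1 2 * swap 4 5)
      ⟨by decide, odd_orderOf_of_pow_eq_one (m := 3) (by decide) (by decide), by decide, by decide,
      by decide, by decide⟩ ht (by decide)
  · exact IsCommWitness.isComm (y := List.formPerm [0, 2, 4, 1, 5])
      (b := List.formPerm [2, 3, 4, 5])
      ⟨by decide, odd_orderOf_of_pow_eq_one (m := 5) (by decide) (by decide), by decide, by decide,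
      by decide, by decide⟩ ht (by decide)

set_option maxRecDepth 4000 in
theorem isComm_of_cycleType_eq_two_two_three {x : Perm α} (hx : x.cycleType = {2, 2, 3}) (s : ℤˣ) :
    IsComm x s := by
  have ht : x.cycleType = (List.formPerm [0, 1] * (List.formPerm [2, 3] *
      List.formPerm [4, 5, 6]) : Perm (Fin 7)).cycleType := by
    rw [Disjoint.cycleType_mul (by unfold Perm.Disjoint; decide),
      Disjoint.cycleType_mul (by unfold Perm.Disjoint; decide), hx,
      cycleType_formPerm (by decide) (by decide), cycleType_formPerm (by decide) (by decide),
      cycleType_formPerm (by decide) (by decide)]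
    rfl
  obtain rfl | rfl := Int.units_eq_one_or s
  · exact IsCommWitness.isComm (y := List.formPerm [0, 2, 1, 3, 4, 5, 6]) (b := swap 2 3 * swap 5 6)
      ⟨by decide, odd_orderOf_of_pow_eq_one (m := 7) (by decide) (by decide), by decide, by decide,
      by decide, by decide⟩ ht (by decide)
  · exact IsCommWitness.isComm (y := List.formPerm [1, 3, 2] * List.formPerm [4, 5, 6])
      (b := swap 0 2 * swap 1 3 * swap 5 6)
      ⟨by decide, odd_orderOf_of_pow_eq_one (m := 3) (by decide) (by decide), by decide, by decide,
      by decide, by decide⟩ ht (by decide)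

theorem exists_isCycle_mul_of_ne_one {x : Perm α} (hx : x ≠ 1) :
    ∃ c r : Perm α, c.IsCycle ∧ Disjoint c r ∧ x = c * r := by
  obtain ⟨a, ha⟩ := Finset.nonempty_iff_ne_empty.2 (mt support_eq_empty_iff.1 hx)
  have hcf := cycleOf_mem_cycleFactorsFinset_iff.2 ha
  have hd := (disjoint_mul_inv_of_mem_cycleFactorsFinset hcf).symm
  exact ⟨_, _, isCycle_cycleOf x (mem_support.1 ha), hd, by rw [hd.commute.eq]; group⟩

theorem exists_isCycle_mul_of_sign_eq_neg_one {x : Perm α} (hx : sign x = -1) :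
    ∃ c r : Perm α, c.IsCycle ∧ sign c = -1 ∧ Disjoint c r ∧ x = c * r := by
  induction x using cycle_induction_on with
  | base_one => simp at hx
  | base_cycles σ hσ => exact ⟨σ, 1, hσ, hx, disjoint_one_right _, by simp⟩
  | induction_disjoint σ τ hd hσ _ ih =>
    obtain hs | hs := Int.units_eq_one_or (sign σ)
    · rw [map_mul, hs, one_mul] at hx
      obtain ⟨c, r, hc, hcs, hcr, rfl⟩ := ih hx
      have hdc : Disjoint σ c ∧ Disjoint σ r := by
        simpa only [disjoint_iff_disjoint_support, hcr.support_mul, Finset.disjoint_union_right]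
          using hd
      exact ⟨c, σ * r, hc, hcs, hdc.1.symm.mul_right hcr, by
        rw [← mul_assoc, hdc.1.commute.eq, mul_assoc]⟩
    · exact ⟨σ, τ, hσ, hs, hd, rfl⟩

/-- Every even permutation is a commutator as in `IsComm` for both signs of `b`, or trivial, or a
product of a double transposition with such a commutator, or a 3-cycle. -/
theorem isComm_cases_of_sign_eq_one {x : Perm α} (hx : sign x = 1) :
    (∀ s, IsComm x s) ∨ x = 1 ∨
      (∃ d r : Perm α, d.cycleType = {2, 2} ∧ IsComm r 1 ∧ Disjoint d r ∧ x = d * r) ∨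
      x.IsThreeCycle := by
  induction hn : x.support.card using Nat.strong_induction_on generalizing x with
  | _ n ih =>
  subst hn
  by_cases h1 : x = 1
  · exact .inr (.inl h1)
  obtain ⟨c, r, hc, hcr, rfl⟩ := exists_isCycle_mul_of_ne_one h1
  have hcs := hc.sign
  have hc2 := hc.two_le_card_support
  have hcard := hcr.card_support_mul
  rw [map_mul] at hx
  by_cases ho : Odd c.support.card
  · rw [ho.neg_one_pow, neg_neg] at hcs
    rw [hcs, one_mul] at hx
    have hr := ih _ (by omega) hx rfl
    by_cases h3 : c.support.card = 3
    · have hc3 := isComm_of_card_support_eq_three h3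
      have hct := hc.cycleType
      rw [h3] at hct
      obtain hr | rfl | ⟨d, r, hd, hr, hdr, rfl⟩ | hr := hr
      · left
        rw [hcr.commute.eq]
        exact IsComm.mul_forall hr hc3 hcr.symm
      · rw [mul_one]
        exact .inr (.inr (.inr hct))
      · left
        have hdc : Disjoint c d ∧ Disjoint c r := by
          simpa only [disjoint_iff_disjoint_support, hdr.support_mul, Finset.disjoint_union_right]
            using hcr
        rw [← mul_assoc]
        refine IsComm.mul_forall (isComm_of_cycleType_eq_two_two_three ?_) hr (hdc.2.mul_left hdr)
        rw [hdc.1.cycleType_mul, hct, hd, add_comm]; rfl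
      · left
        refine isComm_of_cycleType_eq_three_three ?_
        rw [hcr.cycleType_mul, hct, hr.cycleType]; rfl
    · left
      have hc' := isComm_of_odd_card_support hc ho h3
      obtain hr | rfl | ⟨d, r, hd, hr, hdr, rfl⟩ | hr := hr
      · exact IsComm.mul_forall hc' (hr 1) hcr
      · simpa using hc'
      · exact IsComm.mul_forall hc' ((isComm_of_cycleType_eq_two_two hd).mul hr hdr) hcr
      · exact IsComm.mul_forall hc' (isComm_of_card_support_eq_three hr.card_support) hcr
  · have he := Nat.not_odd_iff_even.1 ho
    rw [he.neg_one_pow] at hcs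
    have hrs : sign r = -1 := by rw [hcs] at hx; simpa [neg_eq_iff_eq_neg] using hx
    obtain ⟨d, r, hd, hds, hdr, rfl⟩ := exists_isCycle_mul_of_sign_eq_neg_one hrs
    have hdc : Disjoint c d ∧ Disjoint c r := by
      simpa only [disjoint_iff_disjoint_support, hdr.support_mul, Finset.disjoint_union_right]
        using hcr
    have hed : Even d.support.card := by
      by_contra h
      rw [hd.sign, (Nat.not_even_iff_odd.1 h).neg_one_pow] at hds
      exact absurd hds (by decide)
    rw [map_mul, hds] at hrs
    have hr := ih r.support.card (by rw [hdr.card_support_mul] at hcard; omega)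
      (by simpa using hrs) rfl
    have hp : Disjoint (c * d) r := hdc.2.mul_left hdr
    rw [← mul_assoc]
    by_cases h2 : c.support.card = 2 ∧ d.support.card = 2
    · have ht : (c * d).cycleType = {2, 2} := by
        rw [hdc.1.cycleType_mul, hc.cycleType, hd.cycleType, h2.1, h2.2]; rfl
      obtain hr | rfl | ⟨e, r, he, hr, her, rfl⟩ | hr := hr
      · left
        rw [hp.commute.eq]
        exact IsComm.mul_forall hr (isComm_of_cycleType_eq_two_two ht) hp.symm
      · exact .inr (.inr (.inl ⟨_, 1, ht, isComm_one, hp, rfl⟩))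
      · exact .inr (.inr (.inl ⟨_, _, ht,
          by simpa using (isComm_of_cycleType_eq_two_two he).mul hr her, hp, rfl⟩))
      · left
        refine isComm_of_cycleType_eq_two_two_three ?_
        rw [hp.cycleType_mul, ht, hr.cycleType]; rfl
    · left
      have hcd := isComm_mul_of_even_card_support hc hd hdc.1 he hed h2
      obtain hr | rfl | ⟨e, r, he, hr, her, rfl⟩ | hr := hr
      · exact IsComm.mul_forall hcd (hr 1) hp
      · simpa using hcd
      · exact IsComm.mul_forall hcd ((isComm_of_cycleType_eq_two_two he).mul hr her) hp
      · exact IsComm.mul_forall hcd (isComm_of_card_support_eq_three hr.card_support) hp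

theorem exists_commutator_of_sign_eq_one (hα : 5 ≤ Fintype.card α) {x : Perm α}
    (hx : sign x = 1) :
    ∃ y b : Perm α, Odd (orderOf y) ∧ b ^ 4 = 1 ∧ sign b = 1 ∧ x = y⁻¹ * b⁻¹ * y * b := by
  have key (h : IsComm x 1) :
      ∃ y b : Perm α, Odd (orderOf y) ∧ b ^ 4 = 1 ∧ sign b = 1 ∧ x = y⁻¹ * b⁻¹ * y * b := by
    obtain ⟨y, b, h⟩ := h
    exact ⟨y, b, h.odd, h.pow, h.sign, h.eq⟩
  obtain hr | rfl | ⟨d, r, hd, hr, hdr, rfl⟩ | hr := isComm_cases_of_sign_eq_one hx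
  · exact key (hr 1)
  · exact key isComm_one
  · exact key (by simpa using (isComm_of_cycleType_eq_two_two hd).mul hr hdr)
  · obtain ⟨y, b, h⟩ := isComm_of_card_support_eq_three hr.card_support
    obtain ⟨p, q, hp, hq, hpq⟩ : ∃ p q, p ∉ x.support ∧ q ∉ x.support ∧ p ≠ q :=
      exists_ne_notMem_of_card_add_two_le (by rw [hr.card_support]; exact hα)
    have hy := disjoint_swap_of_notMem_support (fun h' => hp (h.supp_y h'))
      (fun h' => hq (h.supp_y h'))
    have hb := disjoint_swap_of_notMem_support (fun h' => hp (h.supp_b h'))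
      (fun h' => hq (h.supp_b h'))
    refine ⟨y, b * swap p q, h.odd, ?_, ?_, ?_⟩
    · rw [hb.commute.mul_pow, h.pow, pow_succ, pow_succ, pow_succ]; simp
    · rw [map_mul, h.sign, sign_swap hpq]; simp
    · have := commutator_mul_mul_of_commute (t := 1) hy.commute hb.commute
      simpa [h.eq] using this.symm

/-- For `n ≥ 5`, every element of the alternating group `A_n` is a commutator
`[y,b]` with `y` of odd order and the order of `b` dividing 4. -/
theorem alternating_commutator_coprime_orders (n : ℕ) (hn : 5 ≤ n) :
    ∀ x ∈ alternatingGroup (Fin n),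
      ∃ y ∈ alternatingGroup (Fin n), ∃ b ∈ alternatingGroup (Fin n),
        Odd (orderOf y) ∧ orderOf b ∣ 4 ∧ x = y⁻¹ * b⁻¹ * y * b := by
  intro x hx
  obtain ⟨y, b, hy, hb, hbs, he⟩ :=
    exists_commutator_of_sign_eq_one (by simpa using hn) (mem_alternatingGroup.1 hx)
  refine ⟨y, mem_alternatingGroup.2 ?_, b, mem_alternatingGroup.2 hbs, hy,
    orderOf_dvd_of_pow_eq_one hb, he⟩
  have h : sign y ^ orderOf y = 1 := by rw [← map_pow, pow_orderOf_eq_one, map_one]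
  obtain hs | hs := Int.units_eq_one_or (sign y)
  · exact hs
  · rw [hs, hy.neg_one_pow] at h
    exact absurd h (by decide)
end
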